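/- Let n ≥ 3 be an integer and δ₀ ≥ n a constant. Let Ĥ ∈ C⁰((0,∞)) satisfy, for some positive constants C, β and α > 2 with δ₀ + (α−2)(n−α) > 0, the bound 0 ≤ Ĥ(r) ≤ C·r^β·(1+r)^{−β−α} for all 0 < r < ∞. Then for any constant p with 0 < p ≤ β + 2 and p(p+n−2) < δ₀, there exists a unique a ∈ C²((0,∞)) satisfying a''(r) + ((n-1)/r)·a'(r) + (n(n+2)·U(r)^{4/(n-2)} − δ₀/r²)·a(r) = −Ĥ(r) on (0,∞) together with lim_{r→0} a(r) = lim_{r→∞} a(r) = 0; moreover there is a positive constant C₀, depending only on n, δ₀, α, β, p and C, such that 0 ≤ a(r) ≤ C₀·r^p·(1+r)^{−p+2−α} for all 0 < r < ∞. -/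

import Mathlib

open Set Filter

/-- The standard bubble `U(r) = (1 + r²)^{-(n-2)/2}`. -/
noncomputable def U (n : ℕ) (r : ℝ) : ℝ := (1 + r ^ 2) ^ (-(((n : ℝ) - 2) / 2))

/-- `a` is a `C²` solution of
`a'' + ((n-1)/r) a' + (n(n+2) U^{4/(n-2)} − δ₀/r²) a = −Ĥ` on `(0,∞)`
with `a(r) → 0` as `r → 0⁺` and as `r → ∞`. -/
def IsSolODE (n : ℕ) (δ₀ : ℝ) (H : ℝ → ℝ) (a : ℝ → ℝ) : Prop :=
  ContDiffOn ℝ 2 a (Ioi 0) ∧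
  (∀ r ∈ Ioi (0 : ℝ),
    deriv (deriv a) r + ((n : ℝ) - 1) / r * deriv a r +
      ((n : ℝ) * ((n : ℝ) + 2) * U n r ^ ((4 : ℝ) / ((n : ℝ) - 2)) - δ₀ / r ^ 2) * a r
      = -H r) ∧
  Tendsto a (nhdsWithin 0 (Ioi 0)) (nhds 0) ∧
  Tendsto a atTop (nhds 0)

/-- `W`, with derivatives `W₁`, `W₂`, is a positive supersolution of
`W'' + (m - l) W' - l m W = 0` whose logarithmic derivative lies in `[-m, l]`. -/
structure IsBarrier (l m : ℝ) (W W₁ W₂ : ℝ → ℝ) : Prop where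
  pos : ∀ t, 0 < W t
  hasDerivAt : ∀ t, HasDerivAt W (W₁ t) t
  hasDerivAt_deriv : ∀ t, HasDerivAt W₁ (W₂ t) t
  continuous : Continuous W₂
  le_deriv : ∀ t, -(m * W t) ≤ W₁ t
  deriv_le : ∀ t, W₁ t ≤ l * W t
  nonneg : ∀ t, 0 ≤ l * m * W t - (m - l) * W₁ t - W₂ t

namespace IsBarrier

variable {l m N : ℝ} {W W₁ W₂ g : ℝ → ℝ}

theorem comp_neg (h : IsBarrier l m W W₁ W₂) :
    IsBarrier m l (fun t => W (-t)) (fun t => -W₁ (-t)) (fun t => W₂ (-t)) where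
  pos t := h.pos _
  hasDerivAt t := by
    exact ((h.hasDerivAt (-t)).comp t (hasDerivAt_neg t)).congr_deriv (by ring)
  hasDerivAt_deriv t := by
    exact ((h.hasDerivAt_deriv (-t)).comp t (hasDerivAt_neg t)).neg.congr_deriv (by ring)
  continuous := h.continuous.comp continuous_neg
  le_deriv t := neg_le_neg (h.deriv_le (-t))
  deriv_le t := by linarith [h.le_deriv (-t)]
  nonneg t := by linarith [h.nonneg (-t)]

theorem continuous_self (h : IsBarrier l m W W₁ W₂) : Continuous W :=
  continuous_iff_continuousAt.2 fun t => (h.hasDerivAt t).continuousAt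

theorem continuous_deriv (h : IsBarrier l m W W₁ W₂) : Continuous W₁ :=
  continuous_iff_continuousAt.2 fun t => (h.hasDerivAt_deriv t).continuousAt

theorem continuous_residual (h : IsBarrier l m W W₁ W₂) :
    Continuous fun t => l * m * W t - (m - l) * W₁ t - W₂ t := by
  have := h.continuous_self
  have := h.continuous_deriv
  have := h.continuous
  fun_prop

theorem intervalIntegral_residual_le (h : IsBarrier l m W W₁ W₂) (s t : ℝ) :
    ∫ x in s..t, Real.exp (m * x) * (l * m * W x - (m - l) * W₁ x - W₂ x)
      ≤ Real.exp (m * t) * (l * W t - W₁ t) := by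
  have hd : ∀ x, HasDerivAt (fun x => Real.exp (m * x) * (l * W x - W₁ x))
      (Real.exp (m * x) * (l * m * W x - (m - l) * W₁ x - W₂ x)) x := by
    intro x
    have h1 : HasDerivAt (fun x : ℝ => Real.exp (m * x)) (Real.exp (m * x) * m) x := by
      simpa using ((hasDerivAt_id x).const_mul m).exp
    refine (h1.mul (((h.hasDerivAt x).const_mul l).sub (h.hasDerivAt_deriv x))).congr_deriv ?_
    simp only [Pi.sub_apply]
    ring
  have hc := h.continuous_residual
  rw [intervalIntegral.integral_eq_sub_of_hasDerivAt (fun x _ => hd x)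
    (by apply Continuous.intervalIntegrable; fun_prop)]
  have := mul_nonneg (Real.exp_pos (m * s)).le (sub_nonneg.2 (h.deriv_le s))
  linarith

theorem integrableOn_residual (h : IsBarrier l m W W₁ W₂) (t : ℝ) :
    MeasureTheory.IntegrableOn
      (fun x => Real.exp (m * x) * (l * m * W x - (m - l) * W₁ x - W₂ x)) (Iic t) := by
  have hc := h.continuous_residual
  refine MeasureTheory.integrableOn_Iic_of_intervalIntegral_norm_bounded
    (l := atBot) (a := id) (Real.exp (m * t) * (l * W t - W₁ t)) t (fun s => ?_) tendsto_id
    (Eventually.of_forall fun s => ?_)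
  · exact (Continuous.integrableOn_Icc (by fun_prop)).mono_set Ioc_subset_Icc_self
  · refine le_trans (le_of_eq ?_) (h.intervalIntegral_residual_le s t)
    refine intervalIntegral.integral_congr fun x _ => ?_
    exact Real.norm_of_nonneg (mul_nonneg (Real.exp_pos _).le (h.nonneg x))

theorem integral_residual_le (h : IsBarrier l m W W₁ W₂) (t : ℝ) :
    ∫ x in Iic t, Real.exp (m * x) * (l * m * W x - (m - l) * W₁ x - W₂ x)
      ≤ Real.exp (m * t) * (l * W t - W₁ t) :=
  le_of_tendsto (MeasureTheory.intervalIntegral_tendsto_integral_Iic t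
    (h.integrableOn_residual t) tendsto_id)
    (Eventually.of_forall fun s => h.intervalIntegral_residual_le s t)

theorem integrableOn_exp_mul (h : IsBarrier l m W W₁ W₂) (hg : Continuous g)
    (hgN : ∀ t, |g t| ≤ N * (l * m * W t - (m - l) * W₁ t - W₂ t)) (t : ℝ) :
    MeasureTheory.IntegrableOn (fun x => Real.exp (m * x) * g x) (Iic t) := by
  refine MeasureTheory.Integrable.mono' ((h.integrableOn_residual t).const_mul N)
    (Continuous.aestronglyMeasurable (by fun_prop)) (Eventually.of_forall fun x => ?_)
  rw [Real.norm_eq_abs, abs_mul, abs_of_pos (Real.exp_pos _)]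
  nlinarith [hgN x, Real.exp_pos (m * x)]

theorem abs_integral_exp_mul_le (h : IsBarrier l m W W₁ W₂) (hN : 0 ≤ N)
    (hgN : ∀ t, |g t| ≤ N * (l * m * W t - (m - l) * W₁ t - W₂ t)) (t : ℝ) :
    |∫ x in Iic t, Real.exp (m * x) * g x| ≤ N * (Real.exp (m * t) * (l * W t - W₁ t)) := by
  refine le_trans ?_ (mul_le_mul_of_nonneg_left (h.integral_residual_le t) hN)
  rw [← MeasureTheory.integral_const_mul]
  rw [← Real.norm_eq_abs]
  refine MeasureTheory.norm_integral_le_of_norm_le ((h.integrableOn_residual t).const_mul N)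
    (Eventually.of_forall fun x => ?_)
  rw [Real.norm_eq_abs, abs_mul, abs_of_pos (Real.exp_pos _)]
  nlinarith [hgN x, Real.exp_pos (m * x)]

theorem hasDerivAt_integral_exp_mul (h : IsBarrier l m W W₁ W₂) (hg : Continuous g)
    (hgN : ∀ t, |g t| ≤ N * (l * m * W t - (m - l) * W₁ t - W₂ t)) (t : ℝ) :
    HasDerivAt (fun t => ∫ x in Iic t, Real.exp (m * x) * g x) (Real.exp (m * t) * g t) t := by
  have hc : Continuous fun x => Real.exp (m * x) * g x := by fun_prop
  have h1 := (intervalIntegral.integral_hasDerivAt_right (hc.intervalIntegrable 0 t)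
    (hc.stronglyMeasurableAtFilter _ _) hc.continuousAt).const_add
    (∫ x in Iic 0, Real.exp (m * x) * g x)
  refine h1.congr_of_eventuallyEq (Eventually.of_forall fun s => ?_)
  have := intervalIntegral.integral_Iic_sub_Iic (h.integrableOn_exp_mul hg hgN 0)
    (h.integrableOn_exp_mul hg hgN s)
  simp only
  linarith

end IsBarrier

/-- The Green potential of `g` for the operator `v ↦ -(v'' + (m - l) v' - l m v)`. -/
noncomputable def greenPotential (l m : ℝ) (g : ℝ → ℝ) (t : ℝ) : ℝ :=
  (Real.exp (-(m * t)) * (∫ x in Iic t, Real.exp (m * x) * g x) +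
    Real.exp (l * t) * (∫ x in Iic (-t), Real.exp (l * x) * g (-x))) / (l + m)

/-- The derivative of `greenPotential`. -/
noncomputable def greenPotentialDeriv (l m : ℝ) (g : ℝ → ℝ) (t : ℝ) : ℝ :=
  (-m * (Real.exp (-(m * t)) * (∫ x in Iic t, Real.exp (m * x) * g x)) +
    l * (Real.exp (l * t) * (∫ x in Iic (-t), Real.exp (l * x) * g (-x)))) / (l + m)

namespace IsBarrier

variable {l m N : ℝ} {W W₁ W₂ g : ℝ → ℝ}

theorem residual_comp_neg
    (hgN : ∀ t, |g t| ≤ N * (l * m * W t - (m - l) * W₁ t - W₂ t)) (t : ℝ) :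
    |g (-t)| ≤ N * (m * l * W (-t) - (l - m) * -W₁ (-t) - W₂ (-t)) :=
  (hgN (-t)).trans_eq (by ring)

theorem hasDerivAt_left_potential (h : IsBarrier l m W W₁ W₂) (hg : Continuous g)
    (hgN : ∀ t, |g t| ≤ N * (l * m * W t - (m - l) * W₁ t - W₂ t)) (t : ℝ) :
    HasDerivAt (fun t => Real.exp (-(m * t)) * ∫ x in Iic t, Real.exp (m * x) * g x)
      (g t - m * (Real.exp (-(m * t)) * ∫ x in Iic t, Real.exp (m * x) * g x)) t := by
  have h1 : HasDerivAt (fun t : ℝ => Real.exp (-(m * t))) (Real.exp (-(m * t)) * -m) t := by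
    simpa using ((hasDerivAt_id t).const_mul m).neg.exp
  refine (h1.mul (h.hasDerivAt_integral_exp_mul hg hgN t)).congr_deriv ?_
  have : Real.exp (-(m * t)) * Real.exp (m * t) = 1 := by
    rw [← Real.exp_add]; simp
  linear_combination g t * this

theorem hasDerivAt_right_potential (h : IsBarrier l m W W₁ W₂) (hg : Continuous g)
    (hgN : ∀ t, |g t| ≤ N * (l * m * W t - (m - l) * W₁ t - W₂ t)) (t : ℝ) :
    HasDerivAt (fun t => Real.exp (l * t) * ∫ x in Iic (-t), Real.exp (l * x) * g (-x))
      (-g t + l * (Real.exp (l * t) * ∫ x in Iic (-t), Real.exp (l * x) * g (-x))) t := by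
  have h1 := (h.comp_neg.hasDerivAt_left_potential (g := fun x => g (-x))
    (hg.comp continuous_neg) (residual_comp_neg hgN) (-t)).comp t (hasDerivAt_neg t)
  refine (h1.congr_of_eventuallyEq (Eventually.of_forall fun x => ?_)).congr_deriv ?_
  · simp only [Function.comp_apply, mul_neg, neg_neg]
  · simp only [mul_neg, neg_neg]; ring

theorem hasDerivAt_greenPotential (h : IsBarrier l m W W₁ W₂) (hg : Continuous g)
    (hgN : ∀ t, |g t| ≤ N * (l * m * W t - (m - l) * W₁ t - W₂ t)) (t : ℝ) :
    HasDerivAt (greenPotential l m g) (greenPotentialDeriv l m g t) t := by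
  refine (((h.hasDerivAt_left_potential hg hgN t).add
    (h.hasDerivAt_right_potential hg hgN t)).div_const (l + m)).congr_deriv ?_
  unfold greenPotentialDeriv
  ring

theorem hasDerivAt_greenPotentialDeriv (h : IsBarrier l m W W₁ W₂) (hlm : 0 < l + m)
    (hg : Continuous g)
    (hgN : ∀ t, |g t| ≤ N * (l * m * W t - (m - l) * W₁ t - W₂ t)) (t : ℝ) :
    HasDerivAt (greenPotentialDeriv l m g)
      (l * m * greenPotential l m g t - (m - l) * greenPotentialDeriv l m g t - g t) t := by
  refine ((((h.hasDerivAt_left_potential hg hgN t).const_mul (-m)).add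
    ((h.hasDerivAt_right_potential hg hgN t).const_mul l)).div_const (l + m)).congr_deriv ?_
  unfold greenPotentialDeriv greenPotential
  field_simp
  ring

theorem abs_greenPotential_le (h : IsBarrier l m W W₁ W₂) (hlm : 0 < l + m) (hN : 0 ≤ N)
    (hgN : ∀ t, |g t| ≤ N * (l * m * W t - (m - l) * W₁ t - W₂ t)) (t : ℝ) :
    |greenPotential l m g t| ≤ N * W t := by
  have h1 := h.abs_integral_exp_mul_le hN hgN t
  have h2 := h.comp_neg.abs_integral_exp_mul_le (g := fun x => g (-x)) hN
    (residual_comp_neg hgN) (-t)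
  simp only [neg_neg, mul_neg, sub_neg_eq_add] at h2
  have e1 : Real.exp (-(m * t)) * Real.exp (m * t) = 1 := by rw [← Real.exp_add]; simp
  have e2 : Real.exp (l * t) * Real.exp (-(l * t)) = 1 := by rw [← Real.exp_add]; simp
  have h1' := mul_le_mul_of_nonneg_left h1 (Real.exp_pos (-(m * t))).le
  have h2' := mul_le_mul_of_nonneg_left h2 (Real.exp_pos (l * t)).le
  rw [greenPotential, abs_div, abs_of_pos hlm, div_le_iff₀ hlm]
  refine (abs_add_le _ _).trans ?_
  rw [abs_mul, abs_mul, abs_of_pos (Real.exp_pos _), abs_of_pos (Real.exp_pos _)]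
  refine (add_le_add h1' h2').trans_eq ?_
  linear_combination (N * (l * W t - W₁ t)) * e1 + (N * (m * W t + W₁ t)) * e2

theorem greenPotential_sub (h : IsBarrier l m W W₁ W₂) {g' : ℝ → ℝ} {N' : ℝ}
    (hg : Continuous g)
    (hgN : ∀ t, |g t| ≤ N * (l * m * W t - (m - l) * W₁ t - W₂ t)) (hg' : Continuous g')
    (hgN' : ∀ t, |g' t| ≤ N' * (l * m * W t - (m - l) * W₁ t - W₂ t)) (t : ℝ) :
    greenPotential l m g t - greenPotential l m g' t
      = greenPotential l m (fun x => g x - g' x) t := by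
  unfold greenPotential
  simp only [mul_sub]
  rw [MeasureTheory.integral_sub (h.integrableOn_exp_mul hg hgN t)
      (h.integrableOn_exp_mul hg' hgN' t),
    MeasureTheory.integral_sub
      (h.comp_neg.integrableOn_exp_mul (g := fun x => g (-x)) (hg.comp continuous_neg)
        (residual_comp_neg hgN) (-t))
      (h.comp_neg.integrableOn_exp_mul (g := fun x => g' (-x)) (hg'.comp continuous_neg)
        (residual_comp_neg hgN') (-t))]
  ring

/-- Solvability of `v'' + (m - l) v' + (V - l m) v = -H` by a contraction argument in the
space of functions dominated by a barrier. -/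
theorem exists_solution (h : IsBarrier l m W W₁ W₂) (hlm : 0 < l + m) (hN : 0 ≤ N)
    {V H : ℝ → ℝ} {θ : ℝ} (hθ0 : 0 ≤ θ) (hθ : θ < 1) (hV : Continuous V) (hV0 : ∀ t, 0 ≤ V t)
    (hVθ : ∀ t, V t * W t ≤ θ * (l * m * W t - (m - l) * W₁ t - W₂ t))
    (hH : Continuous H)
    (hHN : ∀ t, |H t| ≤ N * (l * m * W t - (m - l) * W₁ t - W₂ t)) :
    ∃ v v₁ : ℝ → ℝ, (∀ t, HasDerivAt v (v₁ t) t) ∧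
      (∀ t, HasDerivAt v₁ (-H t - (m - l) * v₁ t - (V t - l * m) * v t) t) ∧
      ∀ t, |v t| ≤ N / (1 - θ) * W t := by
  have hWc := h.continuous_self
  let S : BoundedContinuousFunction ℝ ℝ → ℝ → ℝ := fun u t => H t + V t * W t * u t
  have hSc : ∀ u, Continuous (S u) := fun u => by
    have := u.continuous
    fun_prop
  have hVu : ∀ (u : BoundedContinuousFunction ℝ ℝ) t, |V t * W t * u t| ≤
      (θ * ‖u‖) * (l * m * W t - (m - l) * W₁ t - W₂ t) := fun u t => by
    rw [abs_mul, abs_of_nonneg (mul_nonneg (hV0 t) (h.pos t).le)]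
    calc V t * W t * |u t| ≤ θ * (l * m * W t - (m - l) * W₁ t - W₂ t) * ‖u‖ :=
          mul_le_mul (hVθ t) (u.norm_coe_le_norm t) (abs_nonneg _)
            (mul_nonneg hθ0 (h.nonneg t))
      _ = _ := by ring
  have hSN : ∀ u t, |S u t| ≤ (N + θ * ‖u‖) * (l * m * W t - (m - l) * W₁ t - W₂ t) :=
    fun u t => (abs_add_le _ _).trans (by linarith [hHN t, hVu u t])
  have hgc : ∀ u, Continuous (greenPotential l m (S u)) := fun u =>
    continuous_iff_continuousAt.2 fun t =>
      (h.hasDerivAt_greenPotential (hSc u) (hSN u) t).continuousAt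
  have hgb : ∀ u t, |greenPotential l m (S u) t| ≤ (N + θ * ‖u‖) * W t := fun u t =>
    h.abs_greenPotential_le hlm (add_nonneg hN (mul_nonneg hθ0 (norm_nonneg u))) (hSN u) t
  let T : BoundedContinuousFunction ℝ ℝ → BoundedContinuousFunction ℝ ℝ := fun u =>
    BoundedContinuousFunction.ofNormedAddCommGroup
      (fun t => greenPotential l m (S u) t / W t)
      ((hgc u).div hWc fun t => (h.pos t).ne') (N + θ * ‖u‖) fun t => by
        rw [Real.norm_eq_abs, abs_div, abs_of_pos (h.pos t), div_le_iff₀ (h.pos t)]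
        exact hgb u t
  have hTapp : ∀ u t, T u t = greenPotential l m (S u) t / W t := fun _ _ => rfl
  have hT : ContractingWith ⟨θ, hθ0⟩ T := by
    refine ⟨by exact_mod_cast hθ, LipschitzWith.of_dist_le_mul fun u w => ?_⟩
    have hb : 0 ≤ θ * ‖u - w‖ := mul_nonneg hθ0 (norm_nonneg _)
    rw [dist_eq_norm u w]
    refine (BoundedContinuousFunction.dist_le hb).2 fun t => ?_
    rw [Real.dist_eq, hTapp, hTapp, ← sub_div, abs_div, abs_of_pos (h.pos t),
      div_le_iff₀ (h.pos t), h.greenPotential_sub (hSc u) (hSN u) (hSc w) (hSN w)]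
    refine h.abs_greenPotential_le hlm hb (fun s => ?_) t
    convert hVu (u - w) s using 2
    simp only [S, BoundedContinuousFunction.coe_sub, Pi.sub_apply]
    ring
  obtain ⟨u, hu⟩ : ∃ u, T u = u := ⟨_, hT.fixedPoint_isFixedPt⟩
  have huW : ∀ t, greenPotential l m (S u) t = W t * u t := fun t => by
    have := hTapp u t
    rw [hu, eq_div_iff (h.pos t).ne'] at this
    rw [← this, mul_comm]
  have hun : ‖u‖ ≤ N + θ * ‖u‖ := by
    refine (BoundedContinuousFunction.norm_le
      (add_nonneg hN (mul_nonneg hθ0 (norm_nonneg u)))).2 fun t => ?_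
    have := hgb u t
    rw [huW, abs_mul, abs_of_pos (h.pos t), mul_comm] at this
    exact le_of_mul_le_mul_right this (h.pos t)
  refine ⟨greenPotential l m (S u), greenPotentialDeriv l m (S u),
    h.hasDerivAt_greenPotential (hSc u) (hSN u), fun t => ?_, fun t => ?_⟩
  · convert h.hasDerivAt_greenPotentialDeriv hlm (hSc u) (hSN u) t using 1
    simp only [S]
    rw [huW]
    ring
  · refine (hgb u t).trans (mul_le_mul_of_nonneg_right ?_ (h.pos t).le)
    rw [le_div_iff₀ (by linarith)]
    nlinarith

end IsBarrier

/-- The second derivative is nonnegative at a global minimum. -/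
theorem nonneg_of_hasDerivAt_of_forall_ge {z z₁ : ℝ → ℝ} {z₂ t₀ : ℝ}
    (hz : ∀ t, HasDerivAt z (z₁ t) t) (hz₁ : HasDerivAt z₁ z₂ t₀) (hmin : ∀ t, z t₀ ≤ z t) :
    z₁ t₀ = 0 ∧ 0 ≤ z₂ := by
  have hloc : IsLocalMin z t₀ := Eventually.of_forall hmin
  have h0 := hloc.hasDerivAt_eq_zero (hz t₀)
  refine ⟨h0, ?_⟩
  by_contra! hneg
  have hdz : deriv z = z₁ := funext fun t => (hz t).deriv
  have hmax : IsLocalMax z t₀ := isLocalMax_of_deriv_deriv_neg (by rwa [hdz, hz₁.deriv])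
    (by rw [hdz, h0]) (hz t₀).continuousAt
  have hconst : z =ᶠ[nhds t₀] fun _ => z t₀ := by
    filter_upwards [hmax] with t ht using le_antisymm ht (hmin t)
  have h2 : z₁ =ᶠ[nhds t₀] fun _ => 0 := by
    rw [← hdz]
    simpa using hconst.deriv
  have := h2.deriv_eq
  rw [hz₁.deriv] at this
  simp only [deriv_const'] at this
  linarith

/-- Comparison principle: in the presence of a strict supersolution bounded below by `1`, a
supersolution vanishing at both ends of the line is nonnegative. -/
theorem nonneg_of_supersolution {ψ ψ₁ ψ₂ w w₁ w₂ q : ℝ → ℝ} {d : ℝ}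
    (hψ : ∀ t, 1 ≤ ψ t) (hψ₁ : ∀ t, HasDerivAt ψ (ψ₁ t) t) (hψ₂ : ∀ t, HasDerivAt ψ₁ (ψ₂ t) t)
    (hψL : ∀ t, ψ₂ t + d * ψ₁ t + q t * ψ t < 0)
    (hw₁ : ∀ t, HasDerivAt w (w₁ t) t) (hw₂ : ∀ t, HasDerivAt w₁ (w₂ t) t)
    (hwL : ∀ t, w₂ t + d * w₁ t + q t * w t ≤ 0)
    (hbot : Tendsto w atBot (nhds 0)) (htop : Tendsto w atTop (nhds 0)) (t : ℝ) : 0 ≤ w t := by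
  by_contra! hneg
  have hpos : ∀ s, 0 < ψ s := fun s => one_pos.trans_le (hψ s)
  have hc : Continuous fun s => w s / ψ s := continuous_iff_continuousAt.2 fun s =>
    (hw₁ s).continuousAt.div (hψ₁ s).continuousAt (hpos s).ne'
  have hu : w t / ψ t < 0 := div_neg_of_neg_of_pos hneg (hpos t)
  have key : ∀ s, w t / ψ t < w s → w t / ψ t ≤ w s / ψ s := fun s hs => by
    rcases le_or_gt 0 (w s) with h0 | h0
    · exact hu.le.trans (div_nonneg h0 (hpos s).le)
    · rw [le_div_iff₀ (hpos s)]
      nlinarith [hψ s]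
  obtain ⟨t₀, ht₀⟩ := hc.exists_forall_le' t (by
    rw [cocompact_eq_atBot_atTop, eventually_sup]
    exact ⟨(hbot.eventually (lt_mem_nhds hu)).mono key,
      (htop.eventually (lt_mem_nhds hu)).mono key⟩)
  set k := w t₀ / ψ t₀ with hk
  have hk0 : k < 0 := (ht₀ t).trans_lt hu
  have hwk : w t₀ = k * ψ t₀ := by rw [hk, div_mul_cancel₀ _ (hpos t₀).ne']
  obtain ⟨h1, h2⟩ := nonneg_of_hasDerivAt_of_forall_ge (z := fun s => w s - k * ψ s)
    (fun s => (hw₁ s).sub ((hψ₁ s).const_mul k)) ((hw₂ t₀).sub ((hψ₂ t₀).const_mul k))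
    (fun s => by
      have := (le_div_iff₀ (hpos s)).1 (ht₀ s)
      simp only [hwk]
      linarith)
  have h3 := hwL t₀
  have h4 := mul_pos_of_neg_of_neg hk0 (hψL t₀)
  rw [hwk] at h3
  have : w₁ t₀ = k * ψ₁ t₀ := by linarith
  rw [this] at h3
  linarith

/-- The squared radius `e^{2t}` compactified to `(0, 1)`. -/
noncomputable def logisticSq (t : ℝ) : ℝ := Real.exp (2 * t) / (1 + Real.exp (2 * t))

/-- The function `e^{2t} / (1 + e^{2t})²`. -/
noncomputable def bump (t : ℝ) : ℝ := Real.exp (2 * t) / (1 + Real.exp (2 * t)) ^ 2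

/-- The function `r^m (1 + r²)^{-q}` in the variable `r = e^t`. -/
noncomputable def profile (m q t : ℝ) : ℝ :=
  Real.exp (m * t - q * Real.log (1 + Real.exp (2 * t)))

/-- The logarithmic derivative of `profile`. -/
noncomputable def profileSlope (m q t : ℝ) : ℝ := m - 2 * q * logisticSq t

theorem bump_eq (t : ℝ) : bump t = logisticSq t * (1 - logisticSq t) := by
  have : 1 + Real.exp (2 * t) ≠ 0 := by positivity
  unfold bump logisticSq
  field_simp
  ring

theorem bump_pos (t : ℝ) : 0 < bump t := by unfold bump; positivity

theorem logisticSq_pos (t : ℝ) : 0 < logisticSq t := by unfold logisticSq; positivity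

theorem logisticSq_lt_one (t : ℝ) : logisticSq t < 1 := by
  unfold logisticSq
  rw [div_lt_one (by positivity)]
  linarith

theorem bump_le_one (t : ℝ) : bump t ≤ 1 := by
  rw [bump_eq]
  nlinarith [logisticSq_pos t, logisticSq_lt_one t]

theorem bump_eq_profile (t : ℝ) : bump t = profile 2 2 t := by
  unfold bump profile
  rw [Real.exp_sub, mul_comm 2 (Real.log _), Real.exp_mul (Real.log _), Real.exp_log (by positivity)]
  norm_cast

theorem continuous_logisticSq : Continuous logisticSq :=
  Continuous.div (by fun_prop) (by fun_prop) fun t => by positivity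

theorem continuous_bump : Continuous bump :=
  Continuous.div (by fun_prop) (by fun_prop) fun t => by positivity

theorem profile_pos (m q t : ℝ) : 0 < profile m q t := Real.exp_pos _

theorem profile_mul (m q m' q' t : ℝ) :
    profile m q t * profile m' q' t = profile (m + m') (q + q') t := by
  unfold profile
  rw [← Real.exp_add]
  ring_nf

theorem profile_pow (m q t : ℝ) (N : ℕ) : profile m q t ^ N = profile (N * m) (N * q) t := by
  unfold profile
  rw [← Real.exp_nat_mul]
  ring_nf

theorem two_mul_le_log (t : ℝ) : 2 * t ≤ Real.log (1 + Real.exp (2 * t)) := by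
  rw [Real.le_log_iff_exp_le (by positivity)]
  linarith

theorem profile_le_profile {m q m' q' : ℝ} (hm : m' ≤ m) (hq : m - m' ≤ 2 * (q - q')) (t : ℝ) :
    profile m q t ≤ profile m' q' t := by
  have h0 : 0 ≤ Real.log (1 + Real.exp (2 * t)) :=
    Real.log_nonneg (by linarith [Real.exp_pos (2 * t)])
  have h1 := two_mul_le_log t
  refine Real.exp_le_exp.2 ?_
  nlinarith [mul_le_mul_of_nonneg_left h1 (sub_nonneg.2 hm), mul_le_mul_of_nonneg_right hq h0]

theorem hasDerivAt_logisticSq (t : ℝ) : HasDerivAt logisticSq (2 * bump t) t := by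
  have h1 : HasDerivAt (fun t : ℝ => Real.exp (2 * t)) (Real.exp (2 * t) * 2) t := by
    simpa using ((hasDerivAt_id t).const_mul 2).exp
  have h0 : 1 + Real.exp (2 * t) ≠ 0 := by positivity
  refine (h1.div (h1.const_add 1) h0).congr_deriv ?_
  unfold bump
  field_simp
  ring

theorem hasDerivAt_profile (m q t : ℝ) :
    HasDerivAt (profile m q) (profileSlope m q t * profile m q t) t := by
  have h1 : HasDerivAt (fun t : ℝ => Real.exp (2 * t)) (Real.exp (2 * t) * 2) t := by
    simpa using ((hasDerivAt_id t).const_mul 2).exp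
  have h0 : 1 + Real.exp (2 * t) ≠ 0 := by positivity
  refine ((((hasDerivAt_id t).const_mul m).sub
    (((h1.const_add 1).log h0).const_mul q)).exp).congr_deriv ?_
  simp only [profile, profileSlope, logisticSq, Pi.sub_apply, id]
  ring

theorem hasDerivAt_profile_deriv (m q t : ℝ) :
    HasDerivAt (fun t => profileSlope m q t * profile m q t)
      ((profileSlope m q t ^ 2 - 4 * q * bump t) * profile m q t) t := by
  refine ((((hasDerivAt_logisticSq t).const_mul (2 * q)).const_sub m).mul
    (hasDerivAt_profile m q t)).congr_deriv ?_
  simp only [profileSlope]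
  ring

theorem continuous_profile (m q : ℝ) : Continuous (profile m q) :=
  continuous_iff_continuousAt.2 fun t => (hasDerivAt_profile m q t).continuousAt

theorem continuous_profileSlope (m q : ℝ) : Continuous (profileSlope m q) := by
  have := continuous_logisticSq
  unfold profileSlope
  fun_prop

theorem profileSlope_mem {m q a b : ℝ} (ha : a ≤ m) (hb : m ≤ b) (ha' : a ≤ m - 2 * q)
    (hb' : m - 2 * q ≤ b) (t : ℝ) : a ≤ profileSlope m q t ∧ profileSlope m q t ≤ b := by
  have h0 := logisticSq_pos t
  have h1 := logisticSq_lt_one t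
  unfold profileSlope
  constructor <;> nlinarith

theorem barrier_quadratic_lt {n δ y l m : ℝ} (hdiff : m - l = n - 2) (hprod : l * m = δ)
    (hl : 0 < l) (hm : 0 < m) (hy : y * (y + n - 2) < δ) : -m ≤ y ∧ y ≤ l := by
  have h : (y - l) * (y + m) < 0 := by
    have : n = m - l + 2 := by linarith
    subst this
    nlinarith
  constructor <;> by_contra! hc <;> nlinarith

/-- Combination of `W = r^{m₁} (1 + r²)^{-(m₁ - m₂)/2}` and a faster decaying strict supersolution
of the linearized operator, in the variable `t = log r`. -/
theorem exists_barrier {n δ m₁ m₂ l m : ℝ} (hn : 2 ≤ n) (hδ : n ≤ δ) (h12 : m₂ ≤ m₁)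
    (h1 : m₁ * (m₁ + n - 2) < δ) (h2 : m₂ * (m₂ + n - 2) < δ) (hdiff : m - l = n - 2)
    (hprod : l * m = δ) (hl : 0 < l) (hm : 0 < m) :
    ∃ (W W₁ W₂ : ℝ → ℝ) (c K : ℝ), 0 < c ∧ 0 < K ∧ IsBarrier l m W W₁ W₂ ∧
      (∀ t, profile m₁ ((m₁ - m₂) / 2) t ≤ W t) ∧
      (∀ t, W t ≤ K * profile m₁ ((m₁ - m₂) / 2) t) ∧
      ∀ t, c * W t ≤ δ * W t - (n - 2) * W₁ t - W₂ t - n * (n + 2) * bump t * W t := by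
  obtain ⟨k, hk0, hk1, hk2, hk⟩ : ∃ k : ℝ, 0 ≤ k ∧ m₁ ≤ 1 + k ∧ 1 - n - k ≤ m₂ ∧
      (1 + k) * (n - 1 + k) < δ := by
    refine ⟨max 0 (max (m₁ - 1) (1 - n - m₂)), le_max_left _ _, ?_, ?_, ?_⟩
    · linarith [le_max_right 0 (max (m₁ - 1) (1 - n - m₂)), le_max_left (m₁ - 1) (1 - n - m₂)]
    · linarith [le_max_right 0 (max (m₁ - 1) (1 - n - m₂)), le_max_right (m₁ - 1) (1 - n - m₂)]
    · rcases max_choice 0 (max (m₁ - 1) (1 - n - m₂)) with h | h <;> rw [h]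
      · linarith
      · rcases max_choice (m₁ - 1) (1 - n - m₂) with h | h <;> rw [h] <;> linarith
  set q := (m₁ - m₂) / 2 with hq
  set qF := n / 2 + k with hqF
  set f := profile m₁ q with hf
  set F := profile (1 + k) qF with hF
  set M := n * (n + 2) with hM
  have hMpos : 0 < M := by positivity
  set c₁ := min (δ - m₁ * (m₁ + n - 2)) (δ - m₂ * (m₂ + n - 2)) with hc₁
  have hc₁pos : 0 < c₁ := lt_min (by linarith) (by linarith)
  have hc₁1 : c₁ ≤ δ - m₁ * (m₁ + n - 2) := min_le_left _ _
  have hc₁2 : c₁ ≤ δ - m₂ * (m₂ + n - 2) := min_le_right _ _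
  set cF := δ - (1 + k) * (n - 1 + k) with hcF
  have hcFpos : 0 < cF := by linarith
  have hfpos : ∀ t, 0 < f t := profile_pos _ _
  have hFpos : ∀ t, 0 < F t := profile_pos _ _
  have hFf : ∀ t, F t ≤ f t := profile_le_profile hk1 (by linarith)
  obtain ⟨N, hN⟩ := exists_nat_ge (max 1 (max ((1 + k - m₁) / 2) ((m₂ + n - 1 + k) / 2)))
  have hN1 : (1 : ℝ) ≤ N := (le_max_left _ _).trans hN
  have hN2 : (1 + k - m₁) / 2 ≤ N := ((le_max_left _ _).trans (le_max_right _ _)).trans hN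
  have hN3 : (m₂ + n - 1 + k) / 2 ≤ N := ((le_max_right _ _).trans (le_max_right _ _)).trans hN
  have hbF : ∀ t, bump t ^ N * f t ≤ F t := fun t => by
    rw [bump_eq_profile, profile_pow, hf, profile_mul]
    exact profile_le_profile (by linarith) (by linarith) t
  set A := 2 * M / c₁ with hA
  have hApos : 0 < A := by positivity
  set B := c₁ / 2 * A ^ N / cF with hB
  have hBpos : 0 < B := by positivity
  have hMb : ∀ t, M * bump t * f t ≤ c₁ / 2 * f t + B * cF * F t := fun t => by
    have hb := bump_pos t
    have e1 : M * bump t = c₁ / 2 * (A * bump t) := by rw [hA]; field_simp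
    have e2 : A * bump t ≤ 1 + (A * bump t) ^ N := by
      rcases le_total (A * bump t) 1 with h | h
      · have : 0 ≤ (A * bump t) ^ N := by positivity
        linarith
      · have := le_self_pow₀ h (n := N) (by rintro rfl; norm_num at hN1)
        linarith
    have e3 : B * cF = c₁ / 2 * A ^ N := by rw [hB]; field_simp
    rw [e1, e3]
    have e4 := mul_le_mul_of_nonneg_left (hbF t) (by positivity : 0 ≤ c₁ / 2 * A ^ N)
    have e5 := mul_le_mul_of_nonneg_left e2 (by have := hfpos t; positivity : 0 ≤ c₁ / 2 * f t)
    rw [mul_pow] at e5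
    linarith
  set sf := profileSlope m₁ q with hsf
  set sF := profileSlope (1 + k) qF with hsF
  have hq1 : m₁ - 2 * q = m₂ := by rw [hq]; ring
  have hqF1 : 1 + k - 2 * qF = 1 - n - k := by rw [hqF]; ring
  obtain ⟨b1, b1'⟩ := barrier_quadratic_lt hdiff hprod hl hm h1
  obtain ⟨b2, b2'⟩ := barrier_quadratic_lt hdiff hprod hl hm h2
  obtain ⟨b3, b3'⟩ := barrier_quadratic_lt (y := 1 + k) hdiff hprod hl hm (by linarith)
  obtain ⟨b4, b4'⟩ := barrier_quadratic_lt (y := 1 - n - k) hdiff hprod hl hm (by linarith)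
  have hsfm := profileSlope_mem b1 b1' (hq1.symm ▸ b2) (hq1.symm ▸ b2')
  have hsFm := profileSlope_mem b3 b3' (hqF1.symm ▸ b4) (hqF1.symm ▸ b4')
  have hLf : ∀ t, c₁ ≤ δ - (n - 2) * sf t - sf t ^ 2 := fun t => by
    have x0 := logisticSq_pos t
    have x1 := logisticSq_lt_one t
    have : sf t = m₁ * (1 - logisticSq t) + m₂ * logisticSq t := by
      rw [hsf, profileSlope, hq]; ring
    rw [this]
    nlinarith [mul_le_mul_of_nonneg_left hc₁1 (sub_nonneg.2 x1.le),
      mul_le_mul_of_nonneg_left hc₁2 x0.le,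
      mul_nonneg (mul_nonneg x0.le (sub_nonneg.2 x1.le)) (sq_nonneg (m₁ - m₂))]
  have hLF : ∀ t, cF ≤ δ - (n - 2) * sF t - (sF t ^ 2 - 4 * qF * bump t) - M * bump t :=
    fun t => by
      have hb : 0 ≤ k * (n + 1 + k) * bump t := by have := bump_pos t; positivity
      have : δ - (n - 2) * sF t - (sF t ^ 2 - 4 * qF * bump t) - M * bump t
          = cF + 4 * (k * (n + 1 + k) * bump t) := by
        rw [hsF, profileSlope, hqF, hM, hcF, bump_eq]; ring
      linarith
  have hmain : ∀ t, c₁ / 2 * f t ≤ δ * (f t + B * F t) - (n - 2) * (sf t * f t + B * (sF t * F t))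
      - ((sf t ^ 2 - 4 * q * bump t) * f t + B * ((sF t ^ 2 - 4 * qF * bump t) * F t))
      - M * bump t * (f t + B * F t) := fun t => by
    have hq0 : 0 ≤ q * bump t * f t :=
      mul_nonneg (mul_nonneg (by linarith) (bump_pos t).le) (hfpos t).le
    have d1 := mul_le_mul_of_nonneg_right (hLf t) (hfpos t).le
    have d2 := mul_le_mul_of_nonneg_right (hLF t) (mul_pos hBpos (hFpos t)).le
    linarith [hMb t]
  have hmain' : ∀ t, c₁ / 2 / (1 + B) * (f t + B * F t) ≤ δ * (f t + B * F t)
      - (n - 2) * (sf t * f t + B * (sF t * F t))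
      - ((sf t ^ 2 - 4 * q * bump t) * f t + B * ((sF t ^ 2 - 4 * qF * bump t) * F t))
      - M * bump t * (f t + B * F t) := fun t => by
    refine le_trans ?_ (hmain t)
    rw [div_mul_eq_mul_div, div_le_iff₀ (by positivity), mul_assoc]
    refine mul_le_mul_of_nonneg_left ?_ (by positivity)
    nlinarith [mul_le_mul_of_nonneg_left (hFf t) hBpos.le]
  have hWpos : ∀ t, 0 < f t + B * F t := fun t =>
    add_pos (hfpos t) (mul_pos hBpos (hFpos t))
  refine ⟨fun t => f t + B * F t, fun t => sf t * f t + B * (sF t * F t),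
    fun t => (sf t ^ 2 - 4 * q * bump t) * f t + B * ((sF t ^ 2 - 4 * qF * bump t) * F t),
    c₁ / 2 / (1 + B), 1 + B, by positivity, by positivity, ?_, ?_, ?_, hmain'⟩
  · refine ⟨hWpos, fun t => ?_, fun t => ?_, ?_, fun t => ?_, fun t => ?_, fun t => ?_⟩
    · exact (hasDerivAt_profile _ _ t).add ((hasDerivAt_profile _ _ t).const_mul B)
    · exact (hasDerivAt_profile_deriv _ _ t).add ((hasDerivAt_profile_deriv _ _ t).const_mul B)
    · have := continuous_profile m₁ q
      have := continuous_profile (1 + k) qF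
      have := continuous_profileSlope m₁ q
      have := continuous_profileSlope (1 + k) qF
      have := continuous_bump
      fun_prop
    · have d1 := mul_le_mul_of_nonneg_right (hsfm t).1 (hfpos t).le
      have d2 := mul_le_mul_of_nonneg_right (hsFm t).1 (mul_pos hBpos (hFpos t)).le
      linarith
    · have d1 := mul_le_mul_of_nonneg_right (hsfm t).2 (hfpos t).le
      have d2 := mul_le_mul_of_nonneg_right (hsFm t).2 (mul_pos hBpos (hFpos t)).le
      linarith
    · have d1 : 0 ≤ c₁ / 2 * f t := by have := hfpos t; positivity
      have d2 : 0 ≤ M * bump t * (f t + B * F t) :=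
        mul_nonneg (mul_nonneg hMpos.le (bump_pos t).le) (hWpos t).le
      rw [hprod, hdiff]
      linarith [hmain t]
  · intro t
    have := mul_pos hBpos (hFpos t)
    simp only
    linarith
  · intro t
    have := mul_le_mul_of_nonneg_left (hFf t) hBpos.le
    simp only
    linarith

theorem U_rpow {n : ℕ} (hn : 3 ≤ n) (r : ℝ) :
    U n r ^ ((4 : ℝ) / ((n : ℝ) - 2)) = ((1 + r ^ 2) ^ 2)⁻¹ := by
  have hn' : (3 : ℝ) ≤ n := by exact_mod_cast hn
  have hn2 : (n : ℝ) - 2 ≠ 0 := by linarith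
  rw [U, ← Real.rpow_mul (by positivity),
    show -(((n : ℝ) - 2) / 2) * (4 / ((n : ℝ) - 2)) = -(2 : ℕ) by field_simp; norm_num,
    Real.rpow_neg (by positivity), Real.rpow_natCast]

theorem U_exp_rpow {n : ℕ} (hn : 3 ≤ n) (t : ℝ) :
    U n (Real.exp t) ^ ((4 : ℝ) / ((n : ℝ) - 2)) * Real.exp t ^ 2 = bump t := by
  rw [U_rpow hn, bump, ← Real.exp_nat_mul]
  push_cast
  ring

/-- A solution of the radial equation solves a constant-drift equation in `t = log r`. -/
theorem IsSolODE.hasDerivAt_comp_exp {n : ℕ} (hn : 3 ≤ n) {δ : ℝ} {H b : ℝ → ℝ}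
    (hb : IsSolODE n δ H b) :
    ∃ w₁ : ℝ → ℝ, (∀ t, HasDerivAt (fun t => b (Real.exp t)) (w₁ t) t) ∧
      ∀ t, HasDerivAt w₁ (-(Real.exp t ^ 2 * H (Real.exp t)) - ((n : ℝ) - 2) * w₁ t
        - ((n : ℝ) * (n + 2) * bump t - δ) * b (Real.exp t)) t := by
  obtain ⟨hC2, hode, -, -⟩ := hb
  have hd : ∀ r, 0 < r → HasDerivAt b (deriv b r) r := fun r hr =>
    ((hC2.differentiableOn (by norm_num)).differentiableAt (Ioi_mem_nhds hr)).hasDerivAt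
  have hC1 : ContDiffOn ℝ 1 (deriv b) (Ioi 0) :=
    ((contDiffOn_succ_iff_deriv_of_isOpen (n := 1) isOpen_Ioi).1
      (by rw [one_add_one_eq_two]; exact hC2)).2.2
  have hd2 : ∀ r, 0 < r → HasDerivAt (deriv b) (deriv (deriv b) r) r := fun r hr =>
    ((hC1.differentiableOn (by norm_num)).differentiableAt (Ioi_mem_nhds hr)).hasDerivAt
  refine ⟨fun t => deriv b (Real.exp t) * Real.exp t, fun t => ?_, fun t => ?_⟩
  · exact (hd _ (Real.exp_pos t)).comp t (Real.hasDerivAt_exp t)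
  · refine (((hd2 _ (Real.exp_pos t)).comp t (Real.hasDerivAt_exp t)).mul
      (Real.hasDerivAt_exp t)).congr_deriv ?_
    have h := hode _ (Real.exp_pos t)
    have hr := (Real.exp_pos t).ne'
    have hU := U_exp_rpow hn t
    rw [← hU]
    simp only [Function.comp_apply]
    field_simp at h
    linear_combination h

/-- Converse of `IsSolODE.hasDerivAt_comp_exp`. -/
theorem isSolODE_comp_log {n : ℕ} (hn : 3 ≤ n) {δ : ℝ} {H v v₁ : ℝ → ℝ}
    (hH : ContinuousOn H (Ioi 0)) (hv : ∀ t, HasDerivAt v (v₁ t) t)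
    (hv₁ : ∀ t, HasDerivAt v₁ (-(Real.exp t ^ 2 * H (Real.exp t)) - ((n : ℝ) - 2) * v₁ t
        - ((n : ℝ) * (n + 2) * bump t - δ) * v t) t)
    (hbot : Tendsto v atBot (nhds 0)) (htop : Tendsto v atTop (nhds 0)) :
    IsSolODE n δ H fun r => v (Real.log r) := by
  have hvc : Continuous v := continuous_iff_continuousAt.2 fun t => (hv t).continuousAt
  have hv₁c : Continuous v₁ := continuous_iff_continuousAt.2 fun t => (hv₁ t).continuousAt
  have hHc : Continuous fun t => H (Real.exp t) :=
    hH.comp_continuous Real.continuous_exp Real.exp_pos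
  have hdv : deriv v = v₁ := funext fun t => (hv t).deriv
  have hdv₁ : deriv v₁ = _ := funext fun t => (hv₁ t).deriv
  have hv₁C : ContDiff ℝ 1 v₁ := by
    refine contDiff_one_iff_deriv.2 ⟨fun t => (hv₁ t).differentiableAt, ?_⟩
    rw [hdv₁]
    exact ((((Real.continuous_exp.pow 2).mul hHc).neg).sub (hv₁c.const_mul _)).sub
      (((continuous_bump.const_mul _).sub continuous_const).mul hvc)
  have hvC : ContDiff ℝ 2 v := by
    rw [← one_add_one_eq_two]
    exact contDiff_succ_iff_deriv.2 ⟨fun t => (hv t).differentiableAt,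
      fun h => absurd h (by simp), hdv ▸ hv₁C⟩
  have hda : ∀ r, 0 < r → HasDerivAt (fun r => v (Real.log r)) (v₁ (Real.log r) * r⁻¹) r :=
    fun r hr => (hv _).comp r (Real.hasDerivAt_log hr.ne')
  refine ⟨?_, fun r hr => ?_, ?_, ?_⟩
  · exact hvC.comp_contDiffOn (Real.contDiffOn_log.mono fun r hr => (ne_of_gt hr : r ≠ 0))
  · have hr0 : 0 < r := hr
    have he : deriv (fun r => v (Real.log r)) =ᶠ[nhds r] fun r => v₁ (Real.log r) * r⁻¹ := by
      filter_upwards [Ioi_mem_nhds hr0] with s hs using (hda s hs).deriv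
    have hdd := ((hv₁ (Real.log r)).comp r (Real.hasDerivAt_log hr0.ne')).mul
      (hasDerivAt_inv hr0.ne')
    have hU := U_exp_rpow hn (Real.log r)
    rw [he.deriv_eq, (hda r hr0).deriv]
    refine (congrArg₂ _ (congrArg₂ _ hdd.deriv rfl) rfl).trans ?_
    rw [Real.exp_log hr0] at hU ⊢
    rw [← hU]
    simp only [Function.comp_apply]
    field_simp
    ring
  · exact hbot.comp Real.tendsto_log_nhdsGT_zero
  · exact htop.comp Real.tendsto_log_atTop

theorem profile_log (m q : ℝ) {r : ℝ} (hr : 0 < r) :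
    profile m q (Real.log r) = r ^ m * (1 + r ^ 2) ^ (-q) := by
  have h2 : Real.exp (2 * Real.log r) = r ^ 2 := by
    rw [mul_comm, Real.exp_mul, Real.exp_log hr]
    norm_cast
  rw [profile, h2, Real.rpow_def_of_pos hr, Real.rpow_def_of_pos (by positivity), ← Real.exp_add]
  ring_nf

theorem rpow_neg_two_mul {r : ℝ} (hr : 0 < r) (q : ℝ) :
    (1 + r) ^ (-(2 * q)) = ((1 + r) ^ 2) ^ (-q) := by
  rw [← Real.rpow_natCast, ← Real.rpow_mul (by positivity)]
  push_cast
  ring_nf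

theorem rpow_mul_le_profile_log (m : ℝ) {q r : ℝ} (hq : 0 ≤ q) (hr : 0 < r) :
    r ^ m * (1 + r) ^ (-(2 * q)) ≤ profile m q (Real.log r) := by
  rw [profile_log m q hr, rpow_neg_two_mul hr]
  refine mul_le_mul_of_nonneg_left ?_ (by positivity)
  exact Real.rpow_le_rpow_of_nonpos (by positivity) (by nlinarith) (by linarith)

theorem profile_log_le (m : ℝ) {q r : ℝ} (hq : 0 ≤ q) (hr : 0 < r) :
    profile m q (Real.log r) ≤ 2 ^ q * (r ^ m * (1 + r) ^ (-(2 * q))) := by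
  rw [profile_log m q hr, rpow_neg_two_mul hr, mul_left_comm]
  refine mul_le_mul_of_nonneg_left ?_ (by positivity)
  have h2 : (2 : ℝ) ^ q = (2⁻¹ : ℝ) ^ (-q) := by
    rw [Real.inv_rpow (by norm_num), Real.rpow_neg (by norm_num), inv_inv]
  rw [h2, ← Real.mul_rpow (by norm_num) (by positivity)]
  exact Real.rpow_le_rpow_of_nonpos (by positivity) (by nlinarith [sq_nonneg (r - 1)])
    (by linarith)

theorem tendsto_profile_atBot {m q : ℝ} (hm : 0 < m) (hq : 0 ≤ q) :
    Tendsto (profile m q) atBot (nhds 0) := by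
  refine squeeze_zero (fun t => (profile_pos m q t).le) (g := fun t => Real.exp (m * t))
    (fun t => ?_) (Real.tendsto_exp_atBot.comp (tendsto_id.const_mul_atBot hm))
  have := Real.log_nonneg (by linarith [Real.exp_pos (2 * t)] : 1 ≤ 1 + Real.exp (2 * t))
  exact Real.exp_le_exp.2 (by nlinarith)

theorem tendsto_profile_atTop {m q : ℝ} (hm : m < 2 * q) (hq : 0 ≤ q) :
    Tendsto (profile m q) atTop (nhds 0) := by
  refine squeeze_zero (fun t => (profile_pos m q t).le)
    (g := fun t => Real.exp ((m - 2 * q) * t)) (fun t => ?_)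
    (Real.tendsto_exp_atBot.comp (tendsto_id.const_mul_atTop_of_neg (by linarith)))
  exact Real.exp_le_exp.2 (by nlinarith [two_mul_le_log t])

theorem exists_indicial_roots {d δ : ℝ} (hδ : 0 < δ) :
    ∃ l m : ℝ, 0 < l ∧ 0 < m ∧ m - l = d ∧ l * m = δ := by
  have hs : √(d ^ 2 + 4 * δ) ^ 2 = d ^ 2 + 4 * δ := Real.sq_sqrt (by positivity)
  have habs : |d| < √(d ^ 2 + 4 * δ) := by
    rw [← Real.sqrt_sq_eq_abs]
    exact Real.sqrt_lt_sqrt (sq_nonneg d) (by linarith)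
  obtain ⟨h1, h2⟩ := abs_lt.1 habs
  exact ⟨(√(d ^ 2 + 4 * δ) - d) / 2, (√(d ^ 2 + 4 * δ) + d) / 2, by linarith, by linarith,
    by ring, by linear_combination hs / 4⟩

theorem sq_mul_source_le {C β α p r h : ℝ} (hC : 0 < C) (hpβ : p ≤ β + 2) (hr : 0 < r)
    (hh : h ≤ C * r ^ β * (1 + r) ^ (-β - α)) :
    r ^ 2 * h ≤ C * (r ^ p * (1 + r) ^ (-p + 2 - α)) := by
  have h1 : r ^ β = r ^ p * r ^ (β + 2 - p) / r ^ 2 := by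
    rw [← Real.rpow_add hr, ← Real.rpow_natCast, ← Real.rpow_sub hr]
    norm_num
  have h2 : (1 + r) ^ (-p + 2 - α) = (1 + r) ^ (-β - α) * (1 + r) ^ (β + 2 - p) := by
    rw [← Real.rpow_add (by positivity)]
    ring_nf
  have h3 : r ^ (β + 2 - p) ≤ (1 + r) ^ (β + 2 - p) :=
    Real.rpow_le_rpow hr.le (by linarith) (by linarith)
  calc r ^ 2 * h ≤ r ^ 2 * (C * r ^ β * (1 + r) ^ (-β - α)) := by gcongr
    _ = C * (r ^ p * ((1 + r) ^ (-β - α) * r ^ (β + 2 - p))) := by rw [h1]; field_simp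
    _ ≤ _ := by rw [h2]; gcongr

/-- existence, uniqueness and sharp bounds for the solution of the
linearized equation on `(0,∞)`, with a constant `C₀` depending only on
`n, δ₀, α, β, p, C`. -/
theorem statement1 (n : ℕ) (hn : 3 ≤ n) (δ₀ C β α p : ℝ)
    (hδ₀ : (n : ℝ) ≤ δ₀) (hC : 0 < C) (hβ : 0 < β) (hα : 2 < α)
    (hδα : 0 < δ₀ + (α - 2) * ((n : ℝ) - α))
    (hp0 : 0 < p) (hpβ : p ≤ β + 2) (hpδ : p * (p + (n : ℝ) - 2) < δ₀) :
    ∃ C₀ : ℝ, 0 < C₀ ∧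
      ∀ H : ℝ → ℝ, ContinuousOn H (Ioi 0) →
        (∀ r ∈ Ioi (0 : ℝ), 0 ≤ H r ∧ H r ≤ C * r ^ β * (1 + r) ^ (-β - α)) →
        ∃ a : ℝ → ℝ, IsSolODE n δ₀ H a ∧
          (∀ b : ℝ → ℝ, IsSolODE n δ₀ H b → EqOn b a (Ioi 0)) ∧
          ∀ r ∈ Ioi (0 : ℝ), 0 ≤ a r ∧ a r ≤ C₀ * r ^ p * (1 + r) ^ (-p + 2 - α) := by
  have hn3 : (3 : ℝ) ≤ n := by exact_mod_cast hn
  have hδpos : 0 < δ₀ := by linarith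
  obtain ⟨l, m, hl, hm, hdiff, hprod⟩ := exists_indicial_roots (d := (n : ℝ) - 2) hδpos
  obtain ⟨W, W₁, W₂, c, K, hc, hK, hW, hfW, hWf, hWL⟩ :=
    exists_barrier (n := n) (m₁ := p) (m₂ := 2 - α) (by linarith) hδ₀ (by linarith) hpδ
      (by linarith) hdiff hprod hl hm
  obtain ⟨ψ, ψ₁, ψ₂, cψ, -, hcψ, -, hψ, hψ1, -, hψL⟩ :=
    exists_barrier (n := n) (m₁ := 0) (m₂ := 0) (by linarith) hδ₀ le_rfl
      (by linarith) (by linarith) hdiff hprod hl hm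
  set q := (p - (2 - α)) / 2 with hq
  have hq0 : 0 < q := by linarith
  have hexp : -p + 2 - α = -(2 * q) := by rw [hq]; ring
  have compare : ∀ {w w₁ w₂ : ℝ → ℝ}, (∀ t, HasDerivAt w (w₁ t) t) →
      (∀ t, HasDerivAt w₁ (w₂ t) t) →
      (∀ t, w₂ t + ((n : ℝ) - 2) * w₁ t + ((n : ℝ) * (n + 2) * bump t - δ₀) * w t ≤ 0) →
      Tendsto w atBot (nhds 0) → Tendsto w atTop (nhds 0) → ∀ t, 0 ≤ w t := by
    refine nonneg_of_supersolution (fun t => ?_) hψ.hasDerivAt hψ.hasDerivAt_deriv (fun t => ?_)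
    · simpa [profile] using hψ1 t
    · have := mul_pos hcψ (hψ.pos t)
      linarith [hψL t]
  set M := (n : ℝ) * (n + 2) with hM
  have hMpos : 0 < M := by positivity
  set θ := M / (M + c) with hθ
  have hθ0 : 0 ≤ θ := by positivity
  have hθ1 : θ < 1 := by rw [hθ, div_lt_one (by positivity)]; linarith
  set D := C / c / (1 - θ) with hD
  have hDpos : 0 < D := div_pos (by positivity) (by linarith)
  refine ⟨D * K * 2 ^ q, by positivity, fun H hH hHb => ?_⟩
  have hHc : Continuous fun t => H (Real.exp t) :=
    hH.comp_continuous Real.continuous_exp Real.exp_pos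
  have hVW : ∀ t, 0 ≤ M * bump t * W t := fun t =>
    mul_nonneg (mul_nonneg hMpos.le (bump_pos t).le) (hW.pos t).le
  obtain ⟨v, v₁, hv, hv₁, hvW⟩ := hW.exists_solution (N := C / c)
    (V := fun t => M * bump t) (H := fun t => Real.exp t ^ 2 * H (Real.exp t)) (by linarith)
    (by positivity) hθ0 hθ1 (continuous_bump.const_mul M)
    (fun t => mul_nonneg hMpos.le (bump_pos t).le)
    (fun t => by
      rw [hprod, hdiff, hθ, div_mul_eq_mul_div, le_div_iff₀ (by positivity)]
      have d1 := mul_le_mul_of_nonneg_left (hWL t) hMpos.le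
      have d2 := mul_le_mul_of_nonneg_left (bump_le_one t)
        (mul_pos (mul_pos hMpos hc) (hW.pos t)).le
      linarith)
    ((Real.continuous_exp.pow 2).mul hHc)
    (fun t => by
      obtain ⟨hH0, hH1⟩ := hHb _ (Real.exp_pos t)
      rw [abs_of_nonneg (by positivity), hprod, hdiff, div_mul_eq_mul_div, le_div_iff₀ hc]
      have d1 := sq_mul_source_le hC hpβ (Real.exp_pos t) hH1
      rw [hexp] at d1
      have d2 := rpow_mul_le_profile_log p hq0.le (Real.exp_pos t)
      rw [Real.log_exp] at d2
      have d3 := mul_le_mul_of_nonneg_left (d2.trans (hfW t)) hC.le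
      have d4 := mul_le_mul_of_nonneg_right (d1.trans d3) hc.le
      have d5 := mul_le_mul_of_nonneg_left (hWL t) hC.le
      have d6 := mul_nonneg hC.le (hVW t)
      linarith)
  simp only [hprod, hdiff] at hv₁
  have hvf : ∀ t, |v t| ≤ D * K * profile p q t := fun t =>
    (hvW t).trans (by rw [mul_assoc]; exact mul_le_mul_of_nonneg_left (hWf t) hDpos.le)
  have hvbot : Tendsto v atBot (nhds 0) := squeeze_zero_norm hvf
    (by simpa using (tendsto_profile_atBot hp0 hq0.le).const_mul (D * K))
  have hvtop : Tendsto v atTop (nhds 0) := squeeze_zero_norm hvf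
    (by simpa using (tendsto_profile_atTop (m := p) (by linarith) hq0.le).const_mul (D * K))
  have hv0 : ∀ t, 0 ≤ v t := compare hv hv₁ (fun t => by
    have := mul_nonneg (sq_nonneg (Real.exp t)) (hHb _ (Real.exp_pos t)).1
    linarith) hvbot hvtop
  refine ⟨fun r => v (Real.log r), isSolODE_comp_log hn hH hv hv₁ hvbot hvtop,
    fun b hb r hr => ?_, fun r hr => ⟨hv0 _, ?_⟩⟩
  · obtain ⟨w₁, hw, hw₁⟩ := hb.hasDerivAt_comp_exp hn
    have hbbot : Tendsto (fun t => b (Real.exp t)) atBot (nhds 0) :=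
      hb.2.2.1.comp Real.tendsto_exp_atBot_nhdsGT
    have hbtop : Tendsto (fun t => b (Real.exp t)) atTop (nhds 0) :=
      hb.2.2.2.comp Real.tendsto_exp_atTop
    have h1 := compare (fun t => (hw t).sub (hv t)) (fun t => (hw₁ t).sub (hv₁ t))
      (fun t => by simp only [Pi.sub_apply]; linarith) ((hbbot.sub hvbot).mono_right (by simp))
      ((hbtop.sub hvtop).mono_right (by simp)) (Real.log r)
    have h2 := compare (fun t => (hv t).sub (hw t)) (fun t => (hv₁ t).sub (hw₁ t))
      (fun t => by simp only [Pi.sub_apply]; linarith) ((hvbot.sub hbbot).mono_right (by simp))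
      ((hvtop.sub hbtop).mono_right (by simp)) (Real.log r)
    simp only [Pi.sub_apply, Real.exp_log hr] at h1 h2
    simp only
    linarith
  · refine (le_abs_self _).trans ((hvf _).trans ?_)
    refine (mul_le_mul_of_nonneg_left (profile_log_le p hq0.le hr) (by positivity)).trans_eq ?_
    rw [hexp]
    ring
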